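/- arXiv:1802.01322 — 3 statements merged into one kernel-verified Lean document; each statement's English description precedes it below -/
import Mathlib

section
/- (Poincaré function for Kähler metrics on a 2n-dimensional manifold, n ≥ 2.) Let n ≥ 2 and define h_0 = h_1 = 0, h_2 = (1/4)·n^2·(n−1)·(n+3), and h_k = C(2n+k+1, k+2) − 2·C(n+k+1, k+2) − 2n·C(n+k, k+1) for k ≥ 3. Then for every real z with 0 < |z| < 1, ∑_{k=0}^∞ h_k z^k = 1/(z^2 (1−z)^{2n}) − 2(nz+1)/(z^2 (1−z)^n) + n^2 (1 − z^2) + (2nz + 1)/z^2. -/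
theorem hasSum_choose_mul_pow_one_div_one_sub_pow {m : ℕ} (hm : 1 ≤ m) {z : ℝ} (hz : |z| < 1) :
    HasSum (fun k : ℕ => ((m + k - 1).choose k : ℝ) * z ^ k) (1 / (1 - z) ^ m) := by
  obtain ⟨m, rfl⟩ := Nat.exists_eq_add_of_le' hm
  convert! hasSum_choose_mul_geometric_of_norm_lt_one m (r := z) (by simpa using hz) using 4 with k
  rw [show m + 1 + k - 1 = k + m by lia, Nat.choose_symm_add]

theorem hasSum_choose_mul_pow_shift_one {m : ℕ} (hm : 1 ≤ m) {z : ℝ} (hz0 : z ≠ 0)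
    (hz : |z| < 1) :
    HasSum (fun k : ℕ => ((m + k).choose (k + 1) : ℝ) * z ^ k) ((1 / (1 - z) ^ m - 1) / z) := by
  have H := ((hasSum_nat_add_iff' 1).mpr
    (hasSum_choose_mul_pow_one_div_one_sub_pow hm hz)).div_const z
  convert! H using 1
  · ext k
    rw [show m + (k + 1) - 1 = m + k by lia]
    field_simp
    ring
  · simp

theorem hasSum_choose_mul_pow_shift_two {m : ℕ} (hm : 1 ≤ m) {z : ℝ} (hz0 : z ≠ 0)
    (hz : |z| < 1) :
    HasSum (fun k : ℕ => ((m + k + 1).choose (k + 2) : ℝ) * z ^ k)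
      ((1 / (1 - z) ^ m - 1 - m * z) / z ^ 2) := by
  have H := ((hasSum_nat_add_iff' 2).mpr
    (hasSum_choose_mul_pow_one_div_one_sub_pow hm hz)).div_const (z ^ 2)
  convert! H using 1
  · ext k
    rw [show m + (k + 2) - 1 = m + k + 1 by lia]
    field_simp
    ring
  · simp [Finset.sum_range_succ, sub_sub]

theorem cast_choose_three (a : ℕ) :
    (a.choose 3 : ℝ) = a * (a - 1) * (a - 2) / 6 := by
  rw [Nat.cast_choose_eq_descPochhammer_div]
  simp [descPochhammer_succ_right, Nat.factorial]

theorem cast_choose_four (a : ℕ) :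
    (a.choose 4 : ℝ) = a * (a - 1) * (a - 2) * (a - 3) / 24 := by
  rw [Nat.cast_choose_eq_descPochhammer_div]
  simp [descPochhammer_succ_right, Nat.factorial]


/-- Poincaré function for Kähler metrics on a 2n-dimensional manifold, n ≥ 2. -/
theorem poincare_kahler_metrics (n : ℕ) (hn : 2 ≤ n) (h : ℕ → ℝ)
    (h_0 : h 0 = 0) (h_1 : h 1 = 0)
    (h_2 : h 2 = (1 / 4) * (n : ℝ) ^ 2 * ((n : ℝ) - 1) * ((n : ℝ) + 3))
    (h_ge3 : ∀ k, 3 ≤ k → h k = ((2 * n + k + 1).choose (k + 2) : ℝ)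
      - 2 * ((n + k + 1).choose (k + 2) : ℝ) - 2 * (n : ℝ) * ((n + k).choose (k + 1) : ℝ))
    (z : ℝ) (hz0 : 0 < |z|) (hz1 : |z| < 1) :
    HasSum (fun k : ℕ => h k * z ^ k)
      (1 / (z ^ 2 * (1 - z) ^ (2 * n)) - 2 * ((n : ℝ) * z + 1) / (z ^ 2 * (1 - z) ^ n)
        + (n : ℝ) ^ 2 * (1 - z ^ 2) + (2 * (n : ℝ) * z + 1) / z ^ 2) := by
  have hz : z ≠ 0 := abs_pos.mp hz0
  have hz' : 1 - z ≠ 0 := (sub_pos.mpr (abs_lt.mp hz1).2).ne'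
  have h2n := hasSum_choose_mul_pow_shift_two (m := 2 * n) (by lia) hz hz1
  have hn2 := hasSum_choose_mul_pow_shift_two (m := n) (by lia) hz hz1
  have hn1 := hasSum_choose_mul_pow_shift_one (m := n) (by lia) hz hz1
  have hcorr : HasSum (fun k : ℕ => (if k = 0 then (n : ℝ) ^ 2 else if k = 2 then -(n : ℝ) ^ 2
      else 0) * z ^ k) ((n : ℝ) ^ 2 * (1 - z ^ 2)) := by
    have H := hasSum_sum_of_ne_finset_zero (L := SummationFilter.unconditional ℕ)
      (s := Finset.range 3) (f := fun k : ℕ => (if k = 0 then (n : ℝ) ^ 2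
        else if k = 2 then -(n : ℝ) ^ 2 else 0) * z ^ k) fun k hk => by
          have : 3 ≤ k := by simpa using hk
          simp [show k ≠ 0 by lia, show k ≠ 2 by lia]
    convert! H using 1
    simp [Finset.sum_range_succ]
    ring
  convert! ((h2n.sub (hn2.mul_left 2)).sub (hn1.mul_left (2 * (n : ℝ)))).add hcorr using 1
  · ext k
    match k with
    | 0 =>
      simp only [h_0, Nat.cast_choose_two, Nat.choose_one_right, zero_add, add_zero]
      push_cast
      simp
      ring
    | 1 =>
      simp only [h_1, Nat.reduceAdd, cast_choose_three, Nat.cast_choose_two]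
      push_cast
      simp
      ring
    | 2 =>
      simp only [h_2, Nat.reduceAdd, cast_choose_three, cast_choose_four]
      push_cast
      simp
      ring
    | k + 3 =>
      rw [h_ge3 (k + 3) (by lia)]
      simp
      ring
  · push_cast
    field_simp
    ring
end

section
/- (Poincaré function for Fedosov/symplectic connections on a 2n-dimensional manifold.) Let n ≥ 1 and define h_0 = 0, h_1 = (1/2)·(n−1)·n·(2n+1)·(2n+3) + δ, h_2 = (1/5)·n·(n+1)·(3n+2)·(4n^2−1) − δ, and h_k = C(2n+2, 3)·C(2n+k−1, k) − C(2n+k+2, k+3) for k ≥ 3, where δ = 1 if n = 1 and δ = 0 if n ≥ 2. Then for every real z with 0 < |z| < 1: if n = 1, ∑_{k=0}^∞ h_k z^k = z(1 + 3z − z^3)/(1−z)^2; if n ≥ 2, ∑_{k=0}^∞ h_k z^k = (2n(2n^2 + 3n + 1) z^3 − 3)/(3 z^3 (1−z)^{2n}) + (1 + 2nz − n(2n+1) z^2 (z^2 − 1))/z^3. -/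
/-- Negative binomial series, with the binomial coefficients indexed by the exponent. -/
theorem hasSum_choose_add_sub_one_mul_pow {N : ℕ} (hN : 1 ≤ N) {z : ℝ} (hz : |z| < 1) :
    HasSum (fun k : ℕ => ((N + k - 1).choose k : ℝ) * z ^ k) (1 / (1 - z) ^ N) := by
  obtain ⟨m, rfl⟩ := Nat.exists_eq_add_of_le' hN
  refine (hasSum_choose_mul_geometric_of_norm_lt_one m (r := z) hz).congr_fun fun k => ?_
  rw [show m + 1 + k - 1 = k + m by omega, Nat.choose_symm_add]

theorem hasSum_choose_add_two_mul_pow {N : ℕ} (hN : 1 ≤ N) {z : ℝ} (hz0 : z ≠ 0)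
    (hz : |z| < 1) :
    HasSum (fun k : ℕ => ((N + k + 2).choose (k + 3) : ℝ) * z ^ k)
      ((1 / (1 - z) ^ N - (1 + N * z + ((N + 1).choose 2 : ℝ) * z ^ 2)) / z ^ 3) := by
  have H := ((hasSum_nat_add_iff' 3).2 (hasSum_choose_add_sub_one_mul_pow hN hz)).div_const (z ^ 3)
  simp only [Finset.sum_range_succ, Finset.sum_range_zero] at H
  have e : ∀ k, ((N + (k + 3) - 1).choose (k + 3) : ℝ) * z ^ (k + 3) / z ^ 3
      = ((N + k + 2).choose (k + 3) : ℝ) * z ^ k := fun k => by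
    rw [show N + (k + 3) - 1 = N + k + 2 by omega, pow_add]
    field_simp
  rw [funext e] at H
  simpa using H

theorem cast_choose_succ_succ (N k : ℕ) :
    ((N + 1).choose (k + 1) : ℝ) = (N + 1) * (N.choose k : ℝ) / (k + 1) := by
  rw [eq_div_iff (by positivity)]
  exact_mod_cast (Nat.add_one_mul_choose_eq N k).symm


/-- Poincaré function for Fedosov (symplectic) connections on a 2n-dimensional manifold, n ≥ 1. -/
theorem poincare_fedosov_connections (n : ℕ) (hn : 1 ≤ n) (h : ℕ → ℝ)
    (h_0 : h 0 = 0)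
    (h_1 : h 1 = (1 / 2) * ((n : ℝ) - 1) * (n : ℝ) * (2 * (n : ℝ) + 1) * (2 * (n : ℝ) + 3)
      + (if n = 1 then (1 : ℝ) else 0))
    (h_2 : h 2 = (1 / 5) * (n : ℝ) * ((n : ℝ) + 1) * (3 * (n : ℝ) + 2) * (4 * (n : ℝ) ^ 2 - 1)
      - (if n = 1 then (1 : ℝ) else 0))
    (h_ge3 : ∀ k, 3 ≤ k → h k = ((2 * n + 2).choose 3 : ℝ) * ((2 * n + k - 1).choose k : ℝ)
      - ((2 * n + k + 2).choose (k + 3) : ℝ))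
    (z : ℝ) (hz0 : 0 < |z|) (hz1 : |z| < 1) :
    (n = 1 → HasSum (fun k : ℕ => h k * z ^ k)
      (z * (1 + 3 * z - z ^ 3) / (1 - z) ^ 2)) ∧
    (2 ≤ n → HasSum (fun k : ℕ => h k * z ^ k)
      ((2 * (n : ℝ) * (2 * (n : ℝ) ^ 2 + 3 * (n : ℝ) + 1) * z ^ 3 - 3)
          / (3 * z ^ 3 * (1 - z) ^ (2 * n))
        + (1 + 2 * (n : ℝ) * z - (n : ℝ) * (2 * (n : ℝ) + 1) * z ^ 2 * (z ^ 2 - 1)) / z ^ 3)) := by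
  have hz : z ≠ 0 := abs_pos.1 hz0
  have hz' : 1 - z ≠ 0 := sub_ne_zero.2 (abs_lt.1 hz1).2.ne'
  have c2 : ((2 * n + 1).choose 2 : ℝ) = n * (2 * n + 1) := by
    rw [cast_choose_succ_succ, Nat.choose_one_right]
    push_cast
    ring
  have c3 : ((2 * n + 2).choose 3 : ℝ) = 2 * n * (2 * n ^ 2 + 3 * n + 1) / 3 := by
    rw [cast_choose_succ_succ, c2]
    push_cast
    ring
  have c4 : ((2 * n + 3).choose 4 : ℝ)
      = (2 * n + 3) * (2 * n * (2 * n ^ 2 + 3 * n + 1) / 3) / 4 := by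
    rw [cast_choose_succ_succ, c3]
    push_cast
    ring
  have c5 : ((2 * n + 4).choose 5 : ℝ)
      = (2 * n + 4) * ((2 * n + 3) * (2 * n * (2 * n ^ 2 + 3 * n + 1) / 3) / 4) / 5 := by
    rw [cast_choose_succ_succ, c4]
    push_cast
    ring
  set δ : ℝ := if n = 1 then 1 else 0 with hδ
  have H := ((((hasSum_choose_add_sub_one_mul_pow (N := 2 * n) (by omega) hz1).mul_left
    ((2 * n + 2).choose 3 : ℝ)).sub
    (hasSum_choose_add_two_mul_pow (N := 2 * n) (by omega) hz hz1)).add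
    (hasSum_ite_eq 1 ((δ - n * (2 * n + 1)) * z))).add (hasSum_ite_eq 2 (-δ * z ^ 2))
  have key : HasSum (fun k : ℕ => h k * z ^ k) _ := H.congr_fun fun k => by
    match k with
    | 0 => simp [h_0]
    | 1 =>
      simp [h_1, c3, c4]
      ring
    | 2 =>
      simp [h_2, c2, c3, c5]
      ring
    | k + 3 =>
      simp [h_ge3 (k + 3) (by omega)]
      ring
  rw [c2, c3] at key
  push_cast at key
  constructor
  · rintro rfl
    convert key using 1
    simp only [hδ, if_true]
    field_simp
    ring
  · intro hn2
    convert key using 1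
    simp only [hδ, if_neg (show n ≠ 1 by omega)]
    field_simp
    ring
end

section
/- (Poincaré function for Weyl structures on an n-dimensional manifold.) Let n ≥ 2 and define h_0 = 0, h_1 = (1/12)·(n^2−4)·(n^2+3) + δ, h_2 = (1/24)·n·(n^2−1)·(n^2 + 2n + 8) − δ, and h_k = (C(n+1,2) − 1)·C(n+k, k+1) + n·C(n+k−1, k) − n·C(n+k+1, k+2) for k ≥ 3, where δ = 1 if n = 2 and δ = 0 if n ≥ 3. Then for every real z with 0 < |z| < 1, ∑_{k=0}^∞ h_k z^k = ( n z^2 + (C(n+1,2) − 1) z − n ) / (z^2 (1−z)^n) − ( (C(n,2) + 1) z (z^2 − 1) − n )/z^2 − δ·z(z − 1). -/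
/-- The negative binomial series `(1 - z) ^ (-n) = ∑ C(n + k - 1, k) z ^ k`. -/
theorem hasSum_choose_mul_pow_of_abs_lt_one {n : ℕ} (hn : 1 ≤ n) {z : ℝ} (hz : |z| < 1) :
    HasSum (fun k : ℕ => ((n + k - 1).choose k : ℝ) * z ^ k) (1 / (1 - z) ^ n) := by
  obtain ⟨m, rfl⟩ := Nat.exists_eq_add_of_le' hn
  refine (hasSum_choose_mul_geometric_of_norm_lt_one m hz).congr_fun fun k => ?_
  rw [show m + 1 + k - 1 = k + m by omega, Nat.choose_symm_add]

theorem cast_add_one_choose_two (n : ℕ) :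
    ((n + 1).choose 2 : ℝ) = n * (n + 1) / 2 := by
  have h : ((n + 1 : ℕ) : ℝ) * n = (n + 1).choose 2 * 2 := by
    exact_mod_cast (by simpa using Nat.add_one_mul_choose_eq n 1)
  push_cast at h
  linarith

theorem cast_add_two_choose_three (n : ℕ) :
    ((n + 2).choose 3 : ℝ) = n * (n + 1) * (n + 2) / 6 := by
  have h : ((n + 2 : ℕ) : ℝ) * (n + 1).choose 2 = (n + 2).choose 3 * 3 := by
    exact_mod_cast Nat.add_one_mul_choose_eq (n + 1) 2
  rw [cast_add_one_choose_two] at h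
  push_cast at h
  linarith

theorem cast_add_three_choose_four (n : ℕ) :
    ((n + 3).choose 4 : ℝ) = n * (n + 1) * (n + 2) * (n + 3) / 24 := by
  have h : ((n + 3 : ℕ) : ℝ) * (n + 2).choose 3 = (n + 3).choose 4 * 4 := by
    exact_mod_cast Nat.add_one_mul_choose_eq (n + 2) 3
  rw [cast_add_two_choose_three] at h
  push_cast at h
  linarith

/-- Poincaré function for Weyl structures on an n-dimensional manifold, n ≥ 2. -/
theorem poincare_weyl_structures (n : ℕ) (hn : 2 ≤ n) (h : ℕ → ℝ)
    (h_0 : h 0 = 0)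
    (h_1 : h 1 = (1 / 12) * ((n : ℝ) ^ 2 - 4) * ((n : ℝ) ^ 2 + 3)
      + (if n = 2 then (1 : ℝ) else 0))
    (h_2 : h 2 = (1 / 24) * (n : ℝ) * ((n : ℝ) ^ 2 - 1) * ((n : ℝ) ^ 2 + 2 * (n : ℝ) + 8)
      - (if n = 2 then (1 : ℝ) else 0))
    (h_ge3 : ∀ k, 3 ≤ k → h k = (((n + 1).choose 2 : ℝ) - 1) * ((n + k).choose (k + 1) : ℝ)
      + (n : ℝ) * ((n + k - 1).choose k : ℝ) - (n : ℝ) * ((n + k + 1).choose (k + 2) : ℝ))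
    (z : ℝ) (hz0 : 0 < |z|) (hz1 : |z| < 1) :
    HasSum (fun k : ℕ => h k * z ^ k)
      (((n : ℝ) * z ^ 2 + (((n + 1).choose 2 : ℝ) - 1) * z - (n : ℝ))
          / (z ^ 2 * (1 - z) ^ n)
        - (((n.choose 2 : ℝ) + 1) * z * (z ^ 2 - 1) - (n : ℝ)) / z ^ 2
        - (if n = 2 then (1 : ℝ) else 0) * z * (z - 1)) := by
  have hz : z ≠ 0 := abs_pos.mp hz0
  have hz' : 1 - z ≠ 0 := by linarith [le_abs_self z]
  set δ : ℝ := if n = 2 then 1 else 0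
  have H := hasSum_choose_mul_pow_of_abs_lt_one (one_le_two.trans hn) hz1
  have H₁ := ((hasSum_nat_add_iff' 1).mpr H).mul_left z⁻¹
  have H₂ := ((hasSum_nat_add_iff' 2).mpr H).mul_left (z ^ 2)⁻¹
  have E₁ := hasSum_ite_eq (1 : ℕ) ((δ - (n.choose 2 + 1)) * z)
  have E₂ := hasSum_ite_eq (2 : ℕ) (-δ * z ^ 2)
  have key := (((H.mul_left (n : ℝ)).add (H₁.mul_left (((n + 1).choose 2 : ℝ) - 1))).sub
    (H₂.mul_left (n : ℝ))).add E₁ |>.add E₂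
  refine (congrArg₂ (fun f a => HasSum (f : ℕ → ℝ) a) (funext fun k => ?_) ?_).mpr key
  · have e₁ : z⁻¹ * (((n + (k + 1) - 1).choose (k + 1) : ℝ) * z ^ (k + 1))
        = ((n + k).choose (k + 1) : ℝ) * z ^ k := by
      rw [show n + (k + 1) - 1 = n + k by omega]
      field_simp
      ring
    have e₂ : (z ^ 2)⁻¹ * (((n + (k + 2) - 1).choose (k + 2) : ℝ) * z ^ (k + 2))
        = ((n + k + 1).choose (k + 2) : ℝ) * z ^ k := by
      rw [show n + (k + 2) - 1 = n + k + 1 by omega]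
      field_simp
      ring
    rw [e₁, e₂]
    match k with
    | 0 =>
      simp [h_0, cast_add_one_choose_two]
      ring
    | 1 =>
      simp [h_1, cast_add_two_choose_three, Nat.cast_choose_two]
      ring
    | 2 =>
      simp [h_2, cast_add_one_choose_two, cast_add_two_choose_three, cast_add_three_choose_four]
      ring
    | k + 3 =>
      simp [h_ge3 (k + 3) (by omega)]
      ring
  · simp only [Finset.sum_range_succ, Finset.sum_range_zero, Nat.cast_choose_two,
      Nat.choose_zero_right, Nat.add_sub_cancel, Nat.choose_one_right]
    push_cast
    field_simp
    ring
end
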